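/- Let W, Ŵ, S, Ŝ ∈ ℝ^{n×r} all have orthonormal columns, assume SᵀW and ŜᵀŴ are invertible, define D = W(SᵀW)⁻¹Sᵀ and D̂ = Ŵ(ŜᵀŴ)⁻¹Ŝᵀ, and assume D̂ ≠ 0 and D̂ ≠ I. Let sin θ_max := ‖(I − ŴŴᵀ)WWᵀ‖₂. Then for every f ∈ ℝⁿ, ‖(I − D̂) D f‖₂ ≤ sin θ_max · ‖D̂‖₂ · ‖D‖₂ · ‖SSᵀ f‖₂. -/

import Mathlib

open Matrix

/-- Spectral norm (operator norm induced by Euclidean vector norms). -/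
noncomputable def spec {m n : ℕ} (M : Matrix (Fin m) (Fin n) ℝ) : ℝ :=
  ‖LinearMap.toContinuousLinearMap (Matrix.toEuclideanLin M)‖

/-- Euclidean norm of a vector. -/
noncomputable def enorm2 {n : ℕ} (v : Fin n → ℝ) : ℝ :=
  Real.sqrt (∑ i, v i ^ 2)

open scoped Matrix.Norms.L2Operator in
theorem spec_eq_norm {m n : ℕ} (M : Matrix (Fin m) (Fin n) ℝ) : spec M = ‖M‖ := rfl

theorem spec_nonneg {m n : ℕ} (M : Matrix (Fin m) (Fin n) ℝ) : 0 ≤ spec M := norm_nonneg _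

theorem enorm2_eq {n : ℕ} (v : Fin n → ℝ) : enorm2 v = ‖WithLp.toLp 2 v‖ := by
  simp [enorm2, EuclideanSpace.norm_eq]

theorem idem_norm {E : Type*} [NormedAddCommGroup E] [InnerProductSpace ℝ E]
    (T : E →L[ℝ] E) (hT : ∀ x, T (T x) = T x) (h0 : T ≠ 0) (x : E) :
    ‖x - T x‖ ≤ ‖T‖ * ‖x‖ := by
  obtain ⟨u, hu⟩ : ∃ u, u = T x := ⟨_, rfl⟩
  obtain ⟨v, hv⟩ : ∃ v, v = x - T x := ⟨_, rfl⟩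
  have hTu : T u = u := by rw [hu, hT]
  have hTv : T v = 0 := by rw [hv, map_sub, hT, sub_self]
  have hx : x = u + v := by rw [hu, hv]; abel
  rw [← hv]
  by_cases hv0 : v = 0
  · rw [hv0, norm_zero]; positivity
  by_cases hu0 : u = 0
  · have h1 : 1 ≤ ‖T‖ := by
      obtain ⟨z, hz⟩ : ∃ z, T z ≠ 0 := by
        by_contra! h
        exact h0 (ContinuousLinearMap.ext h)
      have := T.le_opNorm (T z)
      rw [hT] at this
      have hp : 0 < ‖T z‖ := norm_pos_iff.2 hz
      exact le_of_mul_le_mul_right (by linarith) hp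
    rw [hx, hu0, zero_add]
    nlinarith [norm_nonneg v]
  have hup : 0 < ‖u‖ := norm_pos_iff.2 hu0
  have hvp : 0 < ‖v‖ := norm_pos_iff.2 hv0
  have key := T.le_opNorm ((‖v‖ / ‖u‖) • u + (‖u‖ / ‖v‖) • v)
  have e1 : ‖(‖v‖ / ‖u‖) • u + (‖u‖ / ‖v‖) • v‖ = ‖x‖ := by
    rw [hx, ← sq_eq_sq₀ (norm_nonneg _) (norm_nonneg _), norm_add_sq_real, norm_add_sq_real,
      norm_smul, norm_smul, real_inner_smul_left, real_inner_smul_right]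
    simp only [norm_div, norm_norm]
    field_simp
    ring
  rw [e1, map_add, map_smul, map_smul, hTu, hTv, smul_zero, add_zero, norm_smul, norm_div,
    norm_norm, norm_norm, div_mul_cancel₀ _ hup.ne'] at key
  exact key

open scoped Matrix.Norms.L2Operator in
theorem idem_mat {n : ℕ} (P : Matrix (Fin n) (Fin n) ℝ) (hP : P * P = P) (h0 : P ≠ 0) :
    ‖1 - P‖ ≤ ‖P‖ := by
  rw [Matrix.cstar_norm_def, Matrix.cstar_norm_def]
  refine ContinuousLinearMap.opNorm_le_bound _ (norm_nonneg _) fun x => ?_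
  rw [map_sub, map_one]
  refine idem_norm _ (fun x => ?_) ?_ x
  · rw [← ContinuousLinearMap.mul_apply, ← map_mul, hP]
  · simpa using h0

/-- `‖(I − D̂) D f‖₂ ≤ sin θ_max ‖D̂‖₂ ‖D‖₂ ‖SSᵀ f‖₂`. -/
theorem perturbed_deim_first_cross_term_bound {n r : ℕ}
    (W What S Shat : Matrix (Fin n) (Fin r) ℝ)
    (hW : Wᵀ * W = 1) (hWhat : Whatᵀ * What = 1)
    (hS : Sᵀ * S = 1) (hShat : Shatᵀ * Shat = 1)
    (hInv : IsUnit (Sᵀ * W)) (hInvHat : IsUnit (Shatᵀ * What))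
    (D Dhat : Matrix (Fin n) (Fin n) ℝ)
    (hD : D = W * (Sᵀ * W)⁻¹ * Sᵀ)
    (hDhat : Dhat = What * (Shatᵀ * What)⁻¹ * Shatᵀ)
    (hDhat0 : Dhat ≠ 0) (hDhat1 : Dhat ≠ 1)
    (sinθ : ℝ) (hsinθ : sinθ = spec ((1 - What * Whatᵀ) * (W * Wᵀ))) :
    ∀ f : Fin n → ℝ,
      enorm2 (((1 - Dhat) * D).mulVec f) ≤
        sinθ * spec Dhat * spec D * enorm2 ((S * Sᵀ).mulVec f) := by
  intro f
  have hdet := (Matrix.isUnit_iff_isUnit_det _).1 hInv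
  have hdet' := (Matrix.isUnit_iff_isUnit_det _).1 hInvHat
  have hDW : Dhat * What = What := by
    rw [hDhat, Matrix.mul_assoc, Matrix.mul_assoc, Matrix.nonsing_inv_mul _ hdet', Matrix.mul_one]
  have hidem : Dhat * Dhat = Dhat := by
    conv_lhs => rw [hDhat]
    rw [← hDhat]
    conv_lhs => rw [hDhat]
    simp only [← Matrix.mul_assoc]
    rw [hDhat] at hDW
    rw [hDW, hDhat]
  have hWD : W * Wᵀ * D = D := by
    rw [hD]
    simp only [← Matrix.mul_assoc]
    rw [Matrix.mul_assoc W Wᵀ W, hW, Matrix.mul_one]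
  have hDS : D * (S * Sᵀ) = D := by
    rw [hD, ← Matrix.mul_assoc, Matrix.mul_assoc _ Sᵀ S, hS, Matrix.mul_one]
  have hz : (1 - Dhat) * (1 - What * Whatᵀ) = 1 - Dhat := by
    rw [Matrix.mul_sub, Matrix.mul_one, ← Matrix.mul_assoc, Matrix.sub_mul, hDW, Matrix.one_mul,
      sub_self, Matrix.zero_mul, sub_zero]
  have hfac : (1 - Dhat) * D =
      (1 - Dhat) * ((1 - What * Whatᵀ) * (W * Wᵀ)) * D * (S * Sᵀ) := by
    rw [Matrix.mul_assoc _ D, hDS, ← Matrix.mul_assoc (1 - Dhat), hz, Matrix.mul_assoc, hWD]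
  rw [hfac, ← Matrix.mulVec_mulVec, hsinθ]
  rw [enorm2_eq, enorm2_eq, spec_eq_norm, spec_eq_norm, spec_eq_norm]
  refine (Matrix.l2_opNorm_mulVec _ (WithLp.toLp 2 ((S * Sᵀ).mulVec f))).trans ?_
  refine mul_le_mul_of_nonneg_right ?_ (norm_nonneg _)
  refine (Matrix.l2_opNorm_mul _ _).trans ?_
  refine mul_le_mul_of_nonneg_right ?_ (spec_nonneg D)
  refine (Matrix.l2_opNorm_mul _ _).trans ?_
  rw [mul_comm]
  exact mul_le_mul_of_nonneg_left (idem_mat _ hidem hDhat0) (spec_nonneg _)
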